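/- arXiv:2104.02670 — 2 statements merged into one kernel-verified Lean document; each statement's English description precedes it below -/
import Mathlib

section
/- Let φ be a Drinfeld module of rank r defined over a finite field extension L of k_∞ inside 𝕂 (i.e., A_1, …, A_r ∈ L). Let N ≥ 1 be such that there exist a strict 𝔽_q-basis x_1, …, x_r of φ[t] and elements ξ_1, …, ξ_r ∈ φ[t^N] with, for each j: |ξ_j| < R_φ; φ_{t^{N−1}}(ξ_j) = x_j; and deg φ_{t^{N−1}}(ξ_j) > ⋯ > deg ξ_j. Then the subfields of 𝕂 generated over L by the period lattice and by the t^N-torsion coincide: L(Λ_φ) = L(φ[t^N]). -/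
open Filter

set_option maxHeartbeats 1000000
set_option synthInstance.maxHeartbeats 400000

noncomputable section

namespace DrinfeldRAT

variable (𝕂 : Type) [NontriviallyNormedField 𝕂]

/-- `deg x := log_q ‖x‖`. -/
def degK (q : ℕ) (x : 𝕂) : ℝ := Real.logb q ‖x‖

/-- The action of `φ_t` on `𝕂`: `φ_t(x) = θ x + A_1 x^q + ⋯ + A_r x^{q^r}`. -/
def phiT (q r : ℕ) (θ : 𝕂) (A : ℕ → 𝕂) (x : 𝕂) : 𝕂 :=
  θ * x + ∑ i ∈ Finset.Icc 1 r, A i * x ^ q ^ i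

/-- Membership in `N(φ) = {1 ≤ i ≤ r : A_i ≠ 0}`. -/
def inNphi (r : ℕ) (A : ℕ → 𝕂) (i : ℕ) : Prop := 1 ≤ i ∧ i ≤ r ∧ A i ≠ 0

/-- `μ_n = (deg A_n − q^n)/(q^n − 1)`. -/
def muPhi (q : ℕ) (A : ℕ → 𝕂) (n : ℕ) : ℝ :=
  (degK 𝕂 q (A n) - (q : ℝ) ^ n) / ((q : ℝ) ^ n - 1)

/-- `m` is the smallest index in `N(φ)` at which `μ` is maximal on `N(φ)`. -/
def IsMuIndex (q r : ℕ) (A : ℕ → 𝕂) (m : ℕ) : Prop :=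
  inNphi 𝕂 r A m ∧ (∀ i, inNphi 𝕂 r A i → muPhi 𝕂 q A i ≤ muPhi 𝕂 q A m) ∧
    ∀ m', inNphi 𝕂 r A m' → (∀ i, inNphi 𝕂 r A i → muPhi 𝕂 q A i ≤ muPhi 𝕂 q A m') → m ≤ m'

/-- `R_φ = q^{−μ_m}` (a real power). -/
def Rphi (q : ℕ) (A : ℕ → 𝕂) (m : ℕ) : ℝ := (q : ℝ) ^ (-(muPhi 𝕂 q A m))

/-- The coefficient of `x^{q^n}` in `φ_t(x)`, with `A₀ = θ`. -/
def Acoef (θ : 𝕂) (A : ℕ → 𝕂) (n : ℕ) : 𝕂 := if n = 0 then θ else A n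

/-- Data of the Newton polygon of `φ_t(x)`: vertices `(q^{d_j}, −deg A_{d_j})`,
`0 = d_0 < d_1 < ⋯ < d_s = r`, with strictly increasing edge slopes `λ_1 < ⋯ < λ_s`,
such that every point `(q^n, −deg A_n)` (for `A_n ≠ 0`, including `n = 0`) lies on or
above each edge line (lower convex hull). -/
structure NewtonData (q r : ℕ) (θ : 𝕂) (A : ℕ → 𝕂) where
  s : ℕ
  d : ℕ → ℕ
  lam : ℕ → ℝ
  s_pos : 0 < s
  d_zero : d 0 = 0
  d_last : d s = r
  d_mono : ∀ j < s, d j < d (j + 1)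
  vertex_ne : ∀ j, 1 ≤ j → j ≤ s → A (d j) ≠ 0
  slope_eq : ∀ j, 1 ≤ j → j ≤ s →
    lam j = (degK 𝕂 q (Acoef 𝕂 θ A (d (j - 1))) - degK 𝕂 q (Acoef 𝕂 θ A (d j))) /
      ((q : ℝ) ^ d j - (q : ℝ) ^ d (j - 1))
  lam_mono : ∀ j, 1 ≤ j → j + 1 ≤ s → lam j < lam (j + 1)
  hull : ∀ n ≤ r, Acoef 𝕂 θ A n ≠ 0 → ∀ j, 1 ≤ j → j ≤ s →
    lam j * ((q : ℝ) ^ n - (q : ℝ) ^ d j) + (-(degK 𝕂 q (Acoef 𝕂 θ A (d j)))) ≤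
      -(degK 𝕂 q (Acoef 𝕂 θ A n))

/-- `x 0, …, x (r−1)` is an `𝔽_q`-basis of `φ[t]` (`𝔽_q ⊆ 𝕂` is the set of `c` with `c^q = c`). -/
def IsFqBasis (q r : ℕ) (θ : 𝕂) (A : ℕ → 𝕂) (x : Fin r → 𝕂) : Prop :=
  (∀ j, phiT 𝕂 q r θ A (x j) = 0) ∧
    ∀ y, phiT 𝕂 q r θ A y = 0 →
      ∃! c : Fin r → 𝕂, (∀ j, c j ^ q = c j) ∧ y = ∑ j, c j * x j

/-- Strictness of a basis of `φ[t]` with respect to Newton polygon data: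
`deg x_j = λ_k` for `d_{k−1} < j ≤ d_k` (here `x` is indexed from `0`). -/
def IsStrict (q r : ℕ) (θ : 𝕂) (A : ℕ → 𝕂) (ND : NewtonData 𝕂 q r θ A)
    (x : Fin r → 𝕂) : Prop :=
  ∀ k, 1 ≤ k → k ≤ ND.s → ∀ j : Fin r, ND.d (k - 1) ≤ (j : ℕ) → (j : ℕ) < ND.d k →
    degK 𝕂 q (x j) = ND.lam k

/-- The conditions of Proposition `good-xi` on `ξ_1, …, ξ_r ∈ φ[t^N]`:
`|ξ_j| < R_φ`, `φ_{t^{N−1}}(ξ_j) = x_j`, and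
`deg φ_{t^{N−1}}(ξ_j) > ⋯ > deg φ_t(ξ_j) > deg ξ_j`. -/
def GoodXi (q r N : ℕ) (θ : 𝕂) (A : ℕ → 𝕂) (m : ℕ) (x ξ : Fin r → 𝕂) : Prop :=
  ∀ j, (phiT 𝕂 q r θ A)^[N] (ξ j) = 0 ∧
    ‖ξ j‖ < Rphi 𝕂 q A m ∧
    (phiT 𝕂 q r θ A)^[N - 1] (ξ j) = x j ∧
    ∀ i, i + 1 ≤ N - 1 →
      degK 𝕂 q ((phiT 𝕂 q r θ A)^[i] (ξ j)) < degK 𝕂 q ((phiT 𝕂 q r θ A)^[i + 1] (ξ j))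

/-- Gauss norm of a power series. -/
def gnorm (f : PowerSeries 𝕂) : ℝ := ⨆ i : ℕ, ‖PowerSeries.coeff i f‖

/-- Membership in the Tate algebra `𝕋`: coefficients tend to `0`. -/
def IsTate (f : PowerSeries 𝕂) : Prop :=
  Tendsto (fun i => ‖PowerSeries.coeff i f‖) atTop (nhds 0)

/-- `n`-th Frobenius twist of a power series: coefficients raised to the `q^n` power. -/
def twist (q n : ℕ) (f : PowerSeries 𝕂) : PowerSeries 𝕂 :=
  PowerSeries.mk fun i => PowerSeries.coeff i f ^ q ^ n

/-- Entrywise Frobenius twist of a matrix of power series. -/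
def twistM {r : ℕ} (q n : ℕ) (M : Matrix (Fin r) (Fin r) (PowerSeries 𝕂)) :
    Matrix (Fin r) (Fin r) (PowerSeries 𝕂) :=
  Matrix.of fun i j => twist 𝕂 q n (M i j)

/-- Gauss norm of a matrix: maximum of the Gauss norms of the entries. -/
def mnorm {r : ℕ} (M : Matrix (Fin r) (Fin r) (PowerSeries 𝕂)) : ℝ :=
  ⨆ p : Fin r × Fin r, gnorm 𝕂 (M p.1 p.2)

/-- Membership in `GL_r(𝕋)`: all entries in `𝕋` and two-sided inverse with entries in `𝕋`. -/
def MemGLT {r : ℕ} (M : Matrix (Fin r) (Fin r) (PowerSeries 𝕂)) : Prop :=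
  (∀ i j, IsTate 𝕂 (M i j)) ∧
    ∃ C : Matrix (Fin r) (Fin r) (PowerSeries 𝕂),
      (∀ i j, IsTate 𝕂 (C i j)) ∧ M * C = 1 ∧ C * M = 1

/-- The matrix `Θ`, with entries viewed in `𝕂[[t]]`. -/
def ThetaPS (r : ℕ) (θ : 𝕂) (A : ℕ → 𝕂) : Matrix (Fin r) (Fin r) (PowerSeries 𝕂) :=
  Matrix.of fun i j =>
    if (i : ℕ) + 1 < r then (if (j : ℕ) = (i : ℕ) + 1 then 1 else 0)
    else if (j : ℕ) = 0 then (PowerSeries.X - PowerSeries.C θ) * PowerSeries.C (A r)⁻¹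
    else -(PowerSeries.C (A (j : ℕ)) * PowerSeries.C (A r)⁻¹)

/-- `h = φ_{t^{N−1}}(ξ) + φ_{t^{N−2}}(ξ) t + ⋯ + ξ t^{N−1}` viewed in `𝕂[[t]]`. -/
def hPS (q r N : ℕ) (θ : 𝕂) (A : ℕ → 𝕂) (ξ : 𝕂) : PowerSeries 𝕂 :=
  ∑ mm ∈ Finset.range N, PowerSeries.C ((phiT 𝕂 q r θ A)^[N - 1 - mm] ξ) * PowerSeries.X ^ mm

/-- The matrix `B = (h_j^{(i−1)})`. -/
def BPS (q r N : ℕ) (θ : 𝕂) (A : ℕ → 𝕂) (ξ : Fin r → 𝕂) :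
    Matrix (Fin r) (Fin r) (PowerSeries 𝕂) :=
  Matrix.of fun i j => twist 𝕂 q (i : ℕ) (hPS 𝕂 q r N θ A (ξ j))

/-- Partial products `F F^{(1)} ⋯ F^{(n)}` (successive factors multiplied on the right). -/
def prodTwists {r : ℕ} (q : ℕ) (F : Matrix (Fin r) (Fin r) (PowerSeries 𝕂)) (n : ℕ) :
    Matrix (Fin r) (Fin r) (PowerSeries 𝕂) :=
  ((List.range (n + 1)).map fun k => twistM 𝕂 q k F).prod

/-- Convergence of a sequence of matrices with respect to the Gauss norm. -/
def MTendsto {r : ℕ} (g : ℕ → Matrix (Fin r) (Fin r) (PowerSeries 𝕂))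
    (P : Matrix (Fin r) (Fin r) (PowerSeries 𝕂)) : Prop :=
  Tendsto (fun n => mnorm 𝕂 (g n - P)) atTop (nhds 0)

/-- Shadowed partitions: `(S_1, …, S_r) ∈ P_r(n)` iff `S_i ⊆ {0, …, n−1}` and the translates
`S_i + j`, `0 ≤ j ≤ i−1`, partition `{0, …, n−1}` (here `S i` is the paper's `S_{i+1}`). -/
def IsShadow (r n : ℕ) (S : Fin r → Finset ℕ) : Prop :=
  (∀ i, S i ⊆ Finset.range n) ∧
    ∀ x ∈ Finset.range n, ∃! p : Fin r × ℕ, p.2 ≤ (p.1 : ℕ) ∧ ∃ y ∈ S p.1, x = y + p.2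

open Classical in
/-- The (finite) set `P_r(n)` of shadowed partitions. -/
def shadowFinset (r n : ℕ) : Finset (Fin r → Finset ℕ) :=
  (Fintype.piFinset fun _ : Fin r => (Finset.range n).powerset).filter (IsShadow r n)

/-- `𝓑_n(t)` as an element of `𝕂[[t]]` (expanded on the unit disk). -/
def BnPS (q r : ℕ) (θ : 𝕂) (A : ℕ → 𝕂) (n : ℕ) : PowerSeries 𝕂 :=
  ∑ S ∈ shadowFinset r n, ∏ i : Fin r, ∏ j ∈ S i,
    PowerSeries.C (A ((i : ℕ) + 1) ^ q ^ j) *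
      (PowerSeries.X - PowerSeries.C (θ ^ q ^ ((i : ℕ) + 1 + j)))⁻¹

/-- Partial sums of `ℒ_φ(ξ;t) = Σ_n 𝓑_n(t) ξ^{q^n}`. -/
def LPartial (q r : ℕ) (θ : 𝕂) (A : ℕ → 𝕂) (ξ : 𝕂) (n : ℕ) : PowerSeries 𝕂 :=
  ∑ k ∈ Finset.range (n + 1), BnPS 𝕂 q r θ A k * PowerSeries.C (ξ ^ q ^ k)

/-- The exponential function `exp_φ(z) = Σ α_n z^{q^n}`. -/
def expF (q : ℕ) (α : ℕ → 𝕂) (z : 𝕂) : 𝕂 := ∑' n : ℕ, α n * z ^ q ^ n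

/-- Anderson generating function `f_φ(u;t) = Σ_m exp_φ(u/θ^{m+1}) t^m`. -/
def AGF (q : ℕ) (α : ℕ → 𝕂) (θ u : 𝕂) : PowerSeries 𝕂 :=
  PowerSeries.mk fun mm => expF 𝕂 q α (u / θ ^ (mm + 1))

/-- The subring `A = 𝔽_q[θ]` of `𝕂`. -/
def Asubring (q : ℕ) (θ : 𝕂) : Subring 𝕂 :=
  Subring.closure ({θ} ∪ {c : 𝕂 | c ^ q = c})

/-- `π_1, …, π_r` is an `A`-basis of the period lattice `Λ_φ = ker exp_φ`. -/
def IsPeriodBasis (q r : ℕ) (α : ℕ → 𝕂) (θ : 𝕂) (π : Fin r → 𝕂) : Prop :=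
  (∀ j, expF 𝕂 q α (π j) = 0) ∧
    ∀ z, expF 𝕂 q α z = 0 →
      ∃! a : Fin r → 𝕂, (∀ j, a j ∈ Asubring 𝕂 q θ) ∧ z = ∑ j, a j * π j

/-- Frobenius twist on `𝕂(t)`, induced by a Frobenius endomorphism of `𝕂`. -/
def twistRF (frobq : 𝕂 →+* 𝕂) : RatFunc 𝕂 →+* RatFunc 𝕂 :=
  RatFunc.mapRingHom (Polynomial.mapRingHom frobq) (by
    intro pp hpp
    simp only [Submonoid.mem_comap, Polynomial.coe_mapRingHom]
    rw [mem_nonZeroDivisors_iff_ne_zero] at hpp ⊢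
    exact (Polynomial.map_ne_zero_iff frobq.injective).mpr hpp)

/-- Entrywise `n`-fold Frobenius twist of a matrix over `𝕂(t)`. -/
def twistMRF {r : ℕ} (frobq : 𝕂 →+* 𝕂) (n : ℕ)
    (M : Matrix (Fin r) (Fin r) (RatFunc 𝕂)) : Matrix (Fin r) (Fin r) (RatFunc 𝕂) :=
  Matrix.of fun i j => (fun g => twistRF 𝕂 frobq g)^[n] (M i j)

/-- The matrix `Θ`, with entries viewed in `𝕂(t)`. -/
def ThetaRF (r : ℕ) (θ : 𝕂) (A : ℕ → 𝕂) : Matrix (Fin r) (Fin r) (RatFunc 𝕂) :=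
  Matrix.of fun i j =>
    if (i : ℕ) + 1 < r then (if (j : ℕ) = (i : ℕ) + 1 then 1 else 0)
    else if (j : ℕ) = 0 then (RatFunc.X - RatFunc.C θ) / RatFunc.C (A r)
    else -(RatFunc.C (A (j : ℕ)) / RatFunc.C (A r))

/-- `h` as an element of `𝕂(t)`. -/
def hRF (q r N : ℕ) (θ : 𝕂) (A : ℕ → 𝕂) (ξ : 𝕂) : RatFunc 𝕂 :=
  ∑ mm ∈ Finset.range N, RatFunc.C ((phiT 𝕂 q r θ A)^[N - 1 - mm] ξ) * RatFunc.X ^ mm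

/-- The matrix `B = (h_j^{(i−1)})` over `𝕂(t)`. -/
def BRF (q r N : ℕ) (frobq : 𝕂 →+* 𝕂) (θ : 𝕂) (A : ℕ → 𝕂) (ξ : Fin r → 𝕂) :
    Matrix (Fin r) (Fin r) (RatFunc 𝕂) :=
  Matrix.of fun i j => (fun g => twistRF 𝕂 frobq g)^[(i : ℕ)] (hRF 𝕂 q r N θ A (ξ j))

/-- The matrix `W` with first row `(ξ_1, …, ξ_r)` and all other entries `0`. -/
def WRF (r : ℕ) (ξ : Fin r → 𝕂) : Matrix (Fin r) (Fin r) (RatFunc 𝕂) :=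
  Matrix.of fun i j => if (i : ℕ) = 0 then RatFunc.C (ξ j) else 0

/-- `R_0 = I/(t−θ)` and `R_m = Θ^{−1}(Θ^{−1})^{(1)} ⋯ (Θ^{−1})^{(m−1)}/(t−θ^{q^m})`. -/
def RmRF (r : ℕ) (frobq : 𝕂 →+* 𝕂) (q : ℕ) (θ : 𝕂) (A : ℕ → 𝕂) (mm : ℕ) :
    Matrix (Fin r) (Fin r) (RatFunc 𝕂) :=
  (RatFunc.X - RatFunc.C (θ ^ q ^ mm))⁻¹ •
    ((List.range mm).map fun k => twistMRF 𝕂 frobq k (ThetaRF 𝕂 r θ A)⁻¹).prod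

/-- `𝓑_n(t)` as an element of `𝕂(t)`. -/
def BnRF (q r : ℕ) (θ : 𝕂) (A : ℕ → 𝕂) (n : ℕ) : RatFunc 𝕂 :=
  ∑ S ∈ shadowFinset r n, ∏ i : Fin r, ∏ j ∈ S i,
    RatFunc.C (A ((i : ℕ) + 1) ^ q ^ j) / (RatFunc.X - RatFunc.C (θ ^ q ^ ((i : ℕ) + 1 + j)))

/-- `𝓑_n(t)` for integer `n`, with `𝓑_n = 0` for `n < 0`. -/
def BnRFZ (q r : ℕ) (θ : 𝕂) (A : ℕ → 𝕂) (n : ℤ) : RatFunc 𝕂 :=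
  if n < 0 then 0 else BnRF 𝕂 q r θ A n.toNat

/-- `F = B^{−1} Θ^{−1} B^{(1)}` over `𝕂(t)`. -/
def FRF (q r N : ℕ) (frobq : 𝕂 →+* 𝕂) (θ : 𝕂) (A : ℕ → 𝕂) (ξ : Fin r → 𝕂) :
    Matrix (Fin r) (Fin r) (RatFunc 𝕂) :=
  (BRF 𝕂 q r N frobq θ A ξ)⁻¹ * (ThetaRF 𝕂 r θ A)⁻¹ *
    twistMRF 𝕂 frobq 1 (BRF 𝕂 q r N frobq θ A ξ)

/-- `Π_n = B F F^{(1)} ⋯ F^{(n)}` over `𝕂(t)`. -/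
def PiNRF (q r N : ℕ) (frobq : 𝕂 →+* 𝕂) (θ : 𝕂) (A : ℕ → 𝕂) (ξ : Fin r → 𝕂) (n : ℕ) :
    Matrix (Fin r) (Fin r) (RatFunc 𝕂) :=
  BRF 𝕂 q r N frobq θ A ξ *
    ((List.range (n + 1)).map fun k => twistMRF 𝕂 frobq k (FRF 𝕂 q r N frobq θ A ξ)).prod

section Helpers

set_option linter.unusedSectionVars false

variable {𝕂 : Type} [NontriviallyNormedField 𝕂]

/-- The bound on the coefficients `A_i` coming from the definition of `R_φ`. -/
lemma norm_A_le {q r m : ℕ} {A : ℕ → 𝕂} (hq : 2 ≤ q) (hm : IsMuIndex 𝕂 q r A m) (i : ℕ)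
    (h1 : 1 ≤ i) (h2 : i ≤ r) :
    ‖A i‖ * Rphi 𝕂 q A m ^ q ^ i ≤ Rphi 𝕂 q A m * (q : ℝ) ^ q ^ i := by
  have hq1 : (1 : ℝ) < q := by exact_mod_cast hq
  have hq0 : (0 : ℝ) < q := by linarith
  have hRpos : 0 < Rphi 𝕂 q A m := Real.rpow_pos_of_pos hq0 _
  by_cases hA : A i = 0
  · rw [hA, norm_zero, zero_mul]; positivity
  have hmu := hm.2.1 i ⟨h1, h2, hA⟩
  set μ := muPhi 𝕂 q A m with hμ
  have hqi : (1 : ℝ) < (q : ℝ) ^ i := one_lt_pow₀ hq1 (by omega)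
  have hdeg : degK 𝕂 q (A i) ≤ μ * ((q : ℝ) ^ i - 1) + (q : ℝ) ^ i := by
    unfold muPhi at hmu
    rw [div_le_iff₀ (by linarith)] at hmu
    linarith
  have hn : ‖A i‖ = (q : ℝ) ^ degK 𝕂 q (A i) := by
    unfold degK
    rw [Real.rpow_logb hq0 hq1.ne' (norm_pos_iff.mpr hA)]
  rw [hn]
  unfold Rphi
  rw [← hμ, ← Real.rpow_natCast ((q : ℝ) ^ (-μ)), ← Real.rpow_mul hq0.le,
    ← Real.rpow_natCast (q : ℝ) (q ^ i), ← Real.rpow_add hq0, ← Real.rpow_add hq0]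
  apply Real.rpow_le_rpow_of_exponent_le hq1.le
  push_cast
  linarith

variable [IsUltrametricDist 𝕂]

/-- Uniqueness of coefficients of an everywhere convergent `q`-linear series. -/
lemma coeff_unique {q : ℕ} (hq : 2 ≤ q) (γ : ℕ → 𝕂)
    (hs : ∀ z : 𝕂, HasSum (fun n => γ n * z ^ q ^ n) 0) (n : ℕ) : γ n = 0 := by
  induction n using Nat.strong_induction_on with
  | _ n ih =>
  obtain ⟨C, hC⟩ : ∃ C : ℝ, ∀ k, ‖γ k‖ ≤ C := by
    have h := (hs 1).summable.tendsto_cofinite_zero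
    rw [Nat.cofinite_eq_atTop] at h
    simp only [one_pow, mul_one] at h
    obtain ⟨C, hC⟩ := (Metric.isBounded_range_of_tendsto _ h).exists_norm_le
    exact ⟨C, fun k => hC _ ⟨k, rfl⟩⟩
  have hC0 : 0 ≤ C := (norm_nonneg _).trans (hC 0)
  by_contra hne
  have hpos : 0 < ‖γ n‖ := norm_pos_iff.mpr hne
  obtain ⟨z, hz0, hz⟩ := NormedField.exists_norm_lt 𝕂
    (show (0 : ℝ) < min 1 (‖γ n‖ / (C + 1)) by positivity)
  have hz1 : ‖z‖ ≤ 1 := (hz.trans_le (min_le_left _ _)).le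
  have hz2 : ‖z‖ * (C + 1) < ‖γ n‖ := by
    have := hz.trans_le (min_le_right _ _)
    rwa [lt_div_iff₀ (by positivity)] at this
  have hsum := hs z
  have h1 : γ n * z ^ q ^ n = - ∑' k, (if k = n then 0 else γ k * z ^ q ^ k) := by
    have := hsum.summable.tsum_eq_add_tsum_ite n
    rw [hsum.tsum_eq] at this
    exact eq_neg_of_add_eq_zero_left this.symm
  have h2 : ‖γ n * z ^ q ^ n‖ ≤ C * (‖z‖ * ‖z‖ ^ q ^ n) := by
    rw [h1, norm_neg]
    apply IsUltrametricDist.norm_tsum_le_of_forall_le_of_nonneg (by positivity)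
    intro k
    split_ifs with hk
    · rw [norm_zero]; positivity
    rcases lt_or_gt_of_ne hk with hk | hk
    · rw [ih k hk, zero_mul, norm_zero]; positivity
    · rw [norm_mul, norm_pow, ← pow_succ']
      have : q ^ n + 1 ≤ q ^ k := Nat.pow_lt_pow_right hq hk
      exact mul_le_mul (hC k) (pow_le_pow_of_le_one (norm_nonneg _) hz1 this) (by positivity) hC0
  rw [norm_mul, norm_pow] at h2
  have hzn : 0 < ‖z‖ ^ q ^ n := pow_pos hz0 _
  have h3 : ‖γ n‖ * ‖z‖ ^ q ^ n ≤ (C * ‖z‖) * ‖z‖ ^ q ^ n := by linarith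
  have h4 := le_of_mul_le_mul_right h3 hzn
  nlinarith

lemma hasSum_congr_aux {f g : ℕ → 𝕂} {a : 𝕂} (h : ∀ n, f n = g n) (hg : HasSum g a) :
    HasSum f a := by
  have : f = g := funext h
  rw [this]; exact hg

/-- Recursion for the coefficients of the exponential. -/
lemma alpha_rec {q r : ℕ} (hq : 2 ≤ q) (hF : ∀ n (x y : 𝕂), (x + y) ^ q ^ n = x ^ q ^ n + y ^ q ^ n)
    {θ : 𝕂} {A α : ℕ → 𝕂}
    (hαsum : ∀ z : 𝕂, Summable fun n => α n * z ^ q ^ n)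
    (hαFE : ∀ z : 𝕂, expF 𝕂 q α (θ * z) = phiT 𝕂 q r θ A (expF 𝕂 q α z)) (n : ℕ) :
    α n * (θ ^ q ^ n - θ) =
      ∑ i ∈ Finset.Icc 1 r, if i ≤ n then A i * α (n - i) ^ q ^ i else 0 := by
  have hq0 : 0 < q := by omega
  have key := coeff_unique hq (fun n => α n * θ ^ q ^ n - θ * α n -
      ∑ i ∈ Finset.Icc 1 r, if i ≤ n then A i * α (n - i) ^ q ^ i else 0) (by
    intro z
    have h1 : HasSum (fun n => α n * (θ * z) ^ q ^ n) (expF 𝕂 q α (θ * z)) :=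
      (hαsum (θ * z)).hasSum
    have h2 : HasSum (fun n => α n * z ^ q ^ n) (expF 𝕂 q α z) := (hαsum z).hasSum
    have h3 : ∀ i ∈ Finset.Icc 1 r, HasSum
        (fun n => if i ≤ n then (A i * α (n - i) ^ q ^ i) * z ^ q ^ n else 0)
        (A i * expF 𝕂 q α z ^ q ^ i) := by
      intro i _
      let f : 𝕂 →+ 𝕂 :=
        { toFun := fun x => x ^ q ^ i
          map_zero' := zero_pow (pow_pos hq0 i).ne'
          map_add' := hF i }
      have hf : Continuous f := continuous_pow (q ^ i)
      have h4 := (h2.map f hf).mul_left (A i)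
      have hinj : Function.Injective (fun n : ℕ => n + i) := add_left_injective i
      rw [← hinj.hasSum_iff]
      · refine hasSum_congr_aux (fun n => ?_) h4
        simp only [Function.comp, f, AddMonoidHom.coe_mk, ZeroHom.coe_mk, Nat.le_add_left,
          if_true, Nat.add_sub_cancel]
        rw [mul_pow, ← pow_mul, ← pow_add, mul_assoc]
      · intro k hk
        rw [if_neg]
        intro hik
        exact hk ⟨k - i, by simp [hik]⟩
    have h5 := (h1.sub (h2.mul_left θ)).sub (hasSum_sum h3)
    rw [hαFE, phiT] at h5
    have h0 : θ * expF 𝕂 q α z + ∑ i ∈ Finset.Icc 1 r, A i * expF 𝕂 q α z ^ q ^ i -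
      θ * expF 𝕂 q α z - ∑ i ∈ Finset.Icc 1 r, A i * expF 𝕂 q α z ^ q ^ i = 0 := by ring
    rw [h0] at h5
    refine hasSum_congr_aux (fun n => ?_) h5
    rw [sub_mul, sub_mul, Finset.sum_mul, mul_pow]
    congr 1
    · ring
    · apply Finset.sum_congr rfl
      intro i _
      split_ifs <;> simp) n
  rw [sub_eq_zero] at key
  rw [← key]; ring

lemma norm_theta_sub {q : ℕ} (hq : 2 ≤ q) {θ : 𝕂} (hθ : ‖θ‖ = (q : ℝ)) {n : ℕ} (hn : 1 ≤ n) :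
    ‖θ ^ q ^ n - θ‖ = (q : ℝ) ^ q ^ n := by
  have hq1 : (1 : ℝ) < q := by exact_mod_cast hq
  have h1 : 1 < q ^ n := Nat.one_lt_pow (by omega) (by omega)
  have hlt : (q : ℝ) < (q : ℝ) ^ q ^ n := by
    simpa using pow_lt_pow_right₀ hq1 h1
  rw [sub_eq_add_neg, IsUltrametricDist.norm_add_eq_max_of_norm_ne_norm]
  · rw [norm_neg, norm_pow, hθ, max_eq_left hlt.le]
  · rw [norm_neg, norm_pow, hθ]; exact hlt.ne'

lemma norm_alpha_le {q r m : ℕ} (hq : 2 ≤ q)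
    {θ : 𝕂} (hθ : ‖θ‖ = (q : ℝ)) {A α : ℕ → 𝕂} (hm : IsMuIndex 𝕂 q r A m) (hα0 : α 0 = 1)
    (hrec : ∀ n, α n * (θ ^ q ^ n - θ) =
      ∑ i ∈ Finset.Icc 1 r, if i ≤ n then A i * α (n - i) ^ q ^ i else 0) (n : ℕ) :
    ‖α n‖ * Rphi 𝕂 q A m ^ q ^ n ≤ Rphi 𝕂 q A m := by
  have hq1 : (1 : ℝ) < q := by exact_mod_cast hq
  have hq0 : (0 : ℝ) < q := by linarith
  have hRpos : 0 < Rphi 𝕂 q A m := Real.rpow_pos_of_pos hq0 _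
  have hAle := fun i h1 h2 => norm_A_le (r := r) hq hm i h1 h2
  set R := Rphi 𝕂 q A m
  induction n using Nat.strong_induction_on with
  | _ n ih =>
  rcases Nat.eq_zero_or_pos n with rfl | hn
  · simp [hα0]
  have h1 : ‖α n‖ * (q : ℝ) ^ q ^ n ≤ R * (q : ℝ) ^ q ^ n / R ^ q ^ n := by
    rw [← norm_theta_sub hq hθ hn, ← norm_mul, hrec, norm_theta_sub hq hθ hn]
    apply IsUltrametricDist.norm_sum_le_of_forall_le_of_nonneg (by positivity)
    intro i hi
    rw [Finset.mem_Icc] at hi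
    split_ifs with hin
    · rw [le_div_iff₀ (by positivity), norm_mul, norm_pow]
      have hA := hAle i hi.1 hi.2
      have ha : ‖α (n - i)‖ ^ q ^ i * R ^ q ^ n ≤ R ^ q ^ i := by
        have := pow_le_pow_left₀ (by positivity) (ih (n - i) (by omega)) (q ^ i)
        rw [mul_pow, ← pow_mul, ← pow_add, Nat.sub_add_cancel hin] at this
        exact this
      calc ‖A i‖ * ‖α (n - i)‖ ^ q ^ i * R ^ q ^ n
          = ‖A i‖ * (‖α (n - i)‖ ^ q ^ i * R ^ q ^ n) := by ring
        _ ≤ ‖A i‖ * R ^ q ^ i := by gcongr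
        _ ≤ R * (q : ℝ) ^ q ^ i := hA
        _ ≤ R * (q : ℝ) ^ q ^ n := by
          gcongr
          · exact hq1.le
          · omega
    · rw [norm_zero]; positivity
  rw [le_div_iff₀ (by positivity)] at h1
  have h2 : (‖α n‖ * R ^ q ^ n) * (q : ℝ) ^ q ^ n ≤ R * (q : ℝ) ^ q ^ n := by linarith
  exact le_of_mul_le_mul_right h2 (by positivity)

lemma expF_sub_id {q : ℕ} (hq : 2 ≤ q) {α : ℕ → 𝕂} {R : ℝ} (hR : 0 < R) (hα0 : α 0 = 1)
    (hαsum : ∀ z : 𝕂, Summable fun n => α n * z ^ q ^ n)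
    (hαR : ∀ n, ‖α n‖ * R ^ q ^ n ≤ R) (w : 𝕂) (hw : ‖w‖ ≤ R) :
    ‖expF 𝕂 q α w - w‖ ≤ ‖w‖ * (‖w‖ / R) := by
  have h1 : expF 𝕂 q α w - w = ∑' k, (if k = 0 then 0 else α k * w ^ q ^ k) := by
    unfold expF
    rw [(hαsum w).tsum_eq_add_tsum_ite 0]
    simp [hα0]
  rw [h1]
  apply IsUltrametricDist.norm_tsum_le_of_forall_le_of_nonneg (by positivity)
  intro k
  split_ifs with hk
  · rw [norm_zero]; positivity
  · have h2 : 2 ≤ q ^ k := hq.trans (Nat.le_self_pow hk q)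
    have hs : ‖w‖ / R ≤ 1 := by rw [div_le_one hR]; exact hw
    calc ‖α k * w ^ q ^ k‖ = ‖α k‖ * R ^ q ^ k * (‖w‖ / R) ^ q ^ k := by
          rw [norm_mul, norm_pow, div_pow]; field_simp
      _ ≤ R * (‖w‖ / R) ^ 2 := by
          exact mul_le_mul (hαR k) (pow_le_pow_of_le_one (by positivity) hs h2) (by positivity) hR.le
      _ = ‖w‖ * (‖w‖ / R) := by field_simp

lemma expF_add {q : ℕ} (hF : ∀ n (x y : 𝕂), (x + y) ^ q ^ n = x ^ q ^ n + y ^ q ^ n) {α : ℕ → 𝕂}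
    (hαsum : ∀ z : 𝕂, Summable fun n => α n * z ^ q ^ n) (x y : 𝕂) :
    expF 𝕂 q α (x + y) = expF 𝕂 q α x + expF 𝕂 q α y := by
  unfold expF
  rw [← (hαsum x).tsum_add (hαsum y)]
  simp only [hF, mul_add]

lemma pow_q_pow {q : ℕ} {c : 𝕂} (hc : c ^ q = c) (n : ℕ) : c ^ q ^ n = c := by
  induction n with
  | zero => simp
  | succ n ih => rw [pow_succ, pow_mul, ih, hc]

lemma expF_smul {q : ℕ} {α : ℕ → 𝕂} {c : 𝕂} (hc : c ^ q = c) (x : 𝕂) :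
    expF 𝕂 q α (c * x) = c * expF 𝕂 q α x := by
  unfold expF
  rw [← tsum_mul_left]
  congr 1; funext n
  rw [mul_pow, pow_q_pow hc]; ring

/-- Local surjectivity of the exponential within a closed subfield. -/
lemma exists_log [CompleteSpace 𝕂] {q : ℕ} (hq : 2 ≤ q)
    (hF : ∀ n (x y : 𝕂), (x + y) ^ q ^ n = x ^ q ^ n + y ^ q ^ n)
    {α : ℕ → 𝕂} {R : ℝ} (hR : 0 < R) (hα0 : α 0 = 1)
    (hαsum : ∀ z : 𝕂, Summable fun n => α n * z ^ q ^ n)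
    (hαR : ∀ n, ‖α n‖ * R ^ q ^ n ≤ R) (E : Subfield 𝕂) (hE : IsClosed (E : Set 𝕂))
    (hexpE : ∀ z ∈ E, expF 𝕂 q α z ∈ E) (z : 𝕂) (hz : z ∈ E) (hzR : ‖z‖ < R) :
    ∃ w ∈ E, expF 𝕂 q α w = z := by
  let g : 𝕂 →+ 𝕂 := 
    { toFun := fun w => w - expF 𝕂 q α w
      map_zero' := by
        have := expF_add hF hαsum 0 0
        simp only [add_zero] at this
        have h0 : expF 𝕂 q α (0 : 𝕂) = 0 := by simpa using this
        simp [h0]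
      map_add' := fun x y => by rw [expF_add hF hαsum]; ring }
  have hg : ∀ w, g w = w - expF 𝕂 q α w := fun _ => rfl
  have hgn : ∀ w, ‖w‖ ≤ R → ‖g w‖ ≤ ‖w‖ * (‖w‖ / R) := by
    intro w hw
    rw [hg, norm_sub_rev]
    exact expF_sub_id hq hR hα0 hαsum hαR w hw
  set ρ := ‖z‖ / R with hρ
  have hρ1 : ρ < 1 := by rw [hρ, div_lt_one hR]; exact hzR
  have hρ0 : 0 ≤ ρ := by positivity
  let u : ℕ → 𝕂 := fun k => g^[k] z
  have hus : ∀ k, u (k + 1) = g (u k) := fun k => Function.iterate_succ_apply' _ _ _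
  have hu : ∀ k, ‖u k‖ ≤ ‖z‖ * ρ ^ k := by
    intro k
    induction k with
    | zero => simp [u]
    | succ k ih =>
      have h1 : ‖u k‖ ≤ ‖z‖ := ih.trans (mul_le_of_le_one_right (norm_nonneg _)
        (pow_le_one₀ hρ0 hρ1.le))
      rw [hus]
      calc ‖g (u k)‖ ≤ ‖u k‖ * (‖u k‖ / R) := hgn _ (h1.trans hzR.le)
        _ ≤ (‖z‖ * ρ ^ k) * ρ := by
          gcongr
          rw [hρ]; gcongr
        _ = _ := by ring
  have huE : ∀ k, u k ∈ E := by
    intro k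
    induction k with
    | zero => exact hz
    | succ k ih => rw [hus, hg]; exact E.sub_mem ih (hexpE _ ih)
  have hsum : Summable u := Summable.of_norm_bounded
    (g := fun k => ‖z‖ * ρ ^ k) ((summable_geometric_of_lt_one hρ0 hρ1).mul_left _) hu
  have htend := hsum.hasSum.tendsto_sum_nat
  set w := ∑' k, u k
  set S : ℕ → 𝕂 := fun n => ∑ k ∈ Finset.range n, u k
  have hS : ∀ n, S (n + 1) = z + g (S n) := by
    intro n
    simp only [S]
    rw [Finset.sum_range_succ', map_sum, add_comm]
    simp only [hus]
    rfl
  refine ⟨w, hE.mem_of_tendsto htend (Eventually.of_forall fun n => E.sum_mem fun k _ => huE k), ?_⟩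
  have hgt : Tendsto (fun n => g (S n)) atTop (nhds (g w)) := by
    rw [tendsto_iff_norm_sub_tendsto_zero]
    have h0 : Tendsto (fun n => ‖S n - w‖) atTop (nhds 0) :=
      tendsto_iff_norm_sub_tendsto_zero.mp htend
    apply squeeze_zero' (Eventually.of_forall fun n => norm_nonneg _) _ h0
    filter_upwards [h0.eventually (gt_mem_nhds hR)] with n hn
    rw [← map_sub]
    refine (hgn _ hn.le).trans (mul_le_of_le_one_right (norm_nonneg _) ?_)
    rw [div_le_one hR]; exact hn.le
  have h1 : w = z + g w := by
    refine tendsto_nhds_unique ((tendsto_add_atTop_iff_nat 1).mpr htend) ?_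
    have : Tendsto (fun n => z + g (S n)) atTop (nhds (z + g w)) := hgt.const_add z
    refine this.congr fun n => (hS n).symm
  rw [hg] at h1
  linear_combination h1

lemma expF_eq_zero {q : ℕ} (hq : 2 ≤ q) {α : ℕ → 𝕂} {R : ℝ} (hR : 0 < R) (hα0 : α 0 = 1)
    (hαsum : ∀ z : 𝕂, Summable fun n => α n * z ^ q ^ n)
    (hαR : ∀ n, ‖α n‖ * R ^ q ^ n ≤ R) (w : 𝕂) (hw : ‖w‖ < R) (h : expF 𝕂 q α w = 0) :
    w = 0 := by
  have h1 := expF_sub_id hq hR hα0 hαsum hαR w hw.le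
  rw [h, zero_sub, norm_neg] at h1
  by_contra hne
  have h2 : 0 < ‖w‖ := norm_pos_iff.mpr hne
  have h3 : ‖w‖ / R < 1 := by rw [div_lt_one hR]; exact hw
  nlinarith

open Polynomial in
/-- The torsion of `φ` is cut out by nonconstant polynomials. -/
lemma exists_torsion_poly {K : Type} [Field K] [Algebra K 𝕂] {q r : ℕ} (hq : 2 ≤ q) (hr : 0 < r)
    {θ : 𝕂} {A : ℕ → 𝕂} (hAr : A r ≠ 0) (θ' : K) (A' : ℕ → K) (hθ' : algebraMap K 𝕂 θ' = θ)
    (hA' : ∀ i, 1 ≤ i → i ≤ r → algebraMap K 𝕂 (A' i) = A i) (n : ℕ) :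
    ∃ Q : K[X], Q ≠ 0 ∧ ∀ y, aeval y Q = (phiT 𝕂 q r θ A)^[n] y := by
  let P : K[X] := C θ' * X + ∑ i ∈ Finset.Icc 1 r, C (A' i) * X ^ q ^ i
  have hP : ∀ y : 𝕂, P.eval₂ (algebraMap K 𝕂) y = phiT 𝕂 q r θ A y := by
    intro y
    simp only [P, eval₂_add, eval₂_mul, eval₂_C, eval₂_X, eval₂_finsetSum, eval₂_X_pow, phiT, hθ']
    congr 1
    apply Finset.sum_congr rfl
    intro i hi
    rw [Finset.mem_Icc] at hi
    rw [hA' i hi.1 hi.2]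
  have hc : P.coeff (q ^ r) = A' r := by
    have h1 : 1 < q ^ r := Nat.one_lt_pow (by omega) (by omega)
    simp only [P, coeff_add, coeff_C_mul, finsetSum_coeff, coeff_X_pow, coeff_X]
    rw [if_neg h1.ne, mul_zero, zero_add, Finset.sum_eq_single r]
    · simp
    · intro i _ hi
      rw [if_neg, mul_zero]
      intro h
      exact hi (Nat.pow_right_injective hq h).symm
    · intro h
      exact absurd (Finset.mem_Icc.mpr ⟨hr, le_rfl⟩) h
  have hA'r : A' r ≠ 0 := by
    intro h
    apply hAr
    rw [← hA' r hr le_rfl, h, map_zero]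
  have hd : 0 < P.natDegree :=
    lt_of_lt_of_le (pow_pos (by omega : 0 < q) r) (le_natDegree_of_ne_zero (by rw [hc]; exact hA'r))
  refine ⟨P.comp^[n] X, ?_, ?_⟩
  · intro h
    have h2 := natDegree_iterate_comp (p := P) (q := X) n
    rw [h, natDegree_zero, natDegree_X, mul_one] at h2
    exact (pow_pos hd n).ne h2
  · intro y
    induction n with
    | zero => simp
    | succ n ih =>
      rw [Function.iterate_succ_apply', Function.iterate_succ_apply', aeval_def, eval₂_comp,
        hP, ← aeval_def, ih]

/-- Closedness and algebraicity facts about `L`. -/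
lemma field_facts [CompleteSpace 𝕂] {q r : ℕ} (hq : 2 ≤ q) (hr : 0 < r)
    {θ : 𝕂} {A : ℕ → 𝕂} (hAr : A r ≠ 0) (F : Subfield 𝕂) (hθ1 : 1 < ‖θ‖) (hθF : θ ∈ F)
    (L : Subfield 𝕂) (hkL : closure (F : Set 𝕂) ⊆ (L : Set 𝕂))
    (hAL : ∀ i, 1 ≤ i → i ≤ r → A i ∈ L)
    (hLfin : ∃ (nn : ℕ) (v : Fin nn → 𝕂), (∀ i, v i ∈ L) ∧ ∀ y ∈ L, ∃ c : Fin nn → 𝕂,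
      (∀ i, c i ∈ closure (F : Set 𝕂)) ∧ y = ∑ i, c i * v i) :
    ∃ Alg : 𝕂 → Prop, (∀ n y, (phiT 𝕂 q r θ A)^[n] y = 0 → Alg y) ∧
      ∀ z, Alg z → IsClosed (Subfield.closure ((L : Set 𝕂) ∪ {z}) : Set 𝕂) ∧
        ∀ w ∈ Subfield.closure ((L : Set 𝕂) ∪ {z}), Alg w := by
  classical
  let k : Subfield 𝕂 := F.topologicalClosure
  have hkmem : ∀ x, x ∈ k ↔ x ∈ closure (F : Set 𝕂) := fun x => Iff.rfl
  let _ : NontriviallyNormedField k :=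
    { (SubfieldClass.toNormedField k : NormedField k) with
      non_trivial := ⟨⟨θ, F.le_topologicalClosure hθF⟩, hθ1⟩ }
  have : CompleteSpace k := F.isClosed_topologicalClosure.completeSpace_coe
  let L' : IntermediateField k 𝕂 := L.toIntermediateField (fun x => hkL x.2)
  have hL' : ∀ x, x ∈ L' ↔ x ∈ L := fun x => Iff.rfl
  have : FiniteDimensional k L' := by
    obtain ⟨nn, v, hv, hy⟩ := hLfin
    refine Module.Finite.of_surjective
      (Fintype.linearCombination k (fun i => (⟨v i, hv i⟩ : L'))) ?_
    rintro ⟨y, hyL⟩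
    obtain ⟨c, hc, rfl⟩ := hy y hyL
    refine ⟨fun i => ⟨c i, hc i⟩, ?_⟩
    apply Subtype.ext
    rw [Fintype.linearCombination_apply]
    simp [Algebra.smul_def]
    rfl
  refine ⟨fun y => IsIntegral k y, ?_, ?_⟩
  · intro n y hy
    obtain ⟨Q, hQ0, hQ⟩ := exists_torsion_poly (K := L') (θ := θ) (A := A) hq hr hAr
      (⟨θ, hkL (subset_closure hθF)⟩ : L')
      (fun i => if h : A i ∈ L then (⟨A i, h⟩ : L') else 0) rfl
      (by
        intro i h1 h2
        rw [dif_pos (hAL i h1 h2)]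
        rfl) n
    have h1 : IsAlgebraic L' y := ⟨Q, hQ0, by rw [hQ, hy]⟩
    exact isIntegral_trans y h1.isIntegral
  · intro z hz
    have : FiniteDimensional k (IntermediateField.adjoin k {z}) :=
      IntermediateField.adjoin.finiteDimensional hz
    let E : IntermediateField k 𝕂 := L' ⊔ IntermediateField.adjoin k {z}
    have : FiniteDimensional k E := IntermediateField.finiteDimensional_sup _ _
    have hEeq : Subfield.closure ((L : Set 𝕂) ∪ {z}) = E.toSubfield := by
      apply le_antisymm
      · rw [Subfield.closure_le]
        rintro w (hw | hw)
        · exact (le_sup_left : L' ≤ E) hw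
        · rw [Set.mem_singleton_iff] at hw
          rw [hw]
          exact (le_sup_right : _ ≤ E) (IntermediateField.mem_adjoin_simple_self k z)
      · let E' : IntermediateField k 𝕂 :=
          (Subfield.closure ((L : Set 𝕂) ∪ {z})).toIntermediateField
            (fun x => Subfield.subset_closure (Or.inl (hkL x.2)))
        have : E ≤ E' := by
          apply sup_le
          · intro w hw
            exact Subfield.subset_closure (Or.inl hw)
          · rw [IntermediateField.adjoin_le_iff]
            intro w hw
            exact Subfield.subset_closure (Or.inr hw)
        exact this
    rw [hEeq]
    refine ⟨?_, ?_⟩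
    · have : FiniteDimensional k (Subalgebra.toSubmodule E.toSubalgebra) :=
        (inferInstance : FiniteDimensional k E)
      exact (Subalgebra.toSubmodule E.toSubalgebra).closed_of_finiteDimensional
    · intro w hw
      have : IsIntegral k (⟨w, hw⟩ : E) := Algebra.IsIntegral.isIntegral _
      exact this.map E.val

lemma phiT_add {q r : ℕ} (hF : ∀ n (x y : 𝕂), (x + y) ^ q ^ n = x ^ q ^ n + y ^ q ^ n)
    (θ : 𝕂) (A : ℕ → 𝕂) (x y : 𝕂) :
    phiT 𝕂 q r θ A (x + y) = phiT 𝕂 q r θ A x + phiT 𝕂 q r θ A y := by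
  unfold phiT
  simp only [hF, mul_add, Finset.sum_add_distrib]
  ring

lemma phiT_smul {q r : ℕ} (θ : 𝕂) (A : ℕ → 𝕂) {c : 𝕂} (hc : c ^ q = c) (x : 𝕂) :
    phiT 𝕂 q r θ A (c * x) = c * phiT 𝕂 q r θ A x := by
  unfold phiT
  rw [mul_add, Finset.mul_sum]
  congr 1
  · ring
  · apply Finset.sum_congr rfl
    intro i _
    rw [mul_pow, pow_q_pow hc]; ring

lemma iter_sum {r : ℕ} (f : 𝕂 → 𝕂) (q : ℕ) (hadd : ∀ x y, f (x + y) = f x + f y)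
    (hsmul : ∀ c x, c ^ q = c → f (c * x) = c * f x) (n : ℕ) (c y : Fin r → 𝕂)
    (hc : ∀ j, c j ^ q = c j) :
    f^[n] (∑ j, c j * y j) = ∑ j, c j * f^[n] (y j) := by
  induction n generalizing y with
  | zero => rfl
  | succ n ih =>
    let g : 𝕂 →+ 𝕂 := AddMonoidHom.mk' f hadd
    have h1 : f (∑ j, c j * y j) = ∑ j, c j * f (y j) := by
      change g _ = _
      rw [map_sum]
      exact Finset.sum_congr rfl fun j _ => hsmul _ _ (hc j)
    rw [Function.iterate_succ_apply, h1, ih]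
    simp only [Function.iterate_succ_apply]

lemma iter_sub (f : 𝕂 → 𝕂) (hadd : ∀ x y, f (x + y) = f x + f y) (n : ℕ) (x y : 𝕂) :
    f^[n] (x - y) = f^[n] x - f^[n] y := by
  let g : 𝕂 →+ 𝕂 := AddMonoidHom.mk' f hadd
  induction n generalizing x y with
  | zero => rfl
  | succ n ih =>
    have h1 : f (x - y) = f x - f y := map_sub g x y
    simp only [Function.iterate_succ_apply, h1, ih]

lemma exp_theta_pow {q r : ℕ} {θ : 𝕂} {A α : ℕ → 𝕂}
    (hαFE : ∀ z : 𝕂, expF 𝕂 q α (θ * z) = phiT 𝕂 q r θ A (expF 𝕂 q α z)) (n : ℕ) (z : 𝕂) :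
    expF 𝕂 q α (θ ^ n * z) = (phiT 𝕂 q r θ A)^[n] (expF 𝕂 q α z) := by
  induction n with
  | zero => simp
  | succ n ih => rw [pow_succ', mul_assoc, hαFE, ih, Function.iterate_succ_apply']

/-- Periods lie in any subfield containing `θ`, `𝔽_q` and lifts `π_j` of a basis of `φ[t]`. -/
lemma period_mem {q r : ℕ} (hq : 2 ≤ q) (hr : 0 < r)
    (hF : ∀ n (x y : 𝕂), (x + y) ^ q ^ n = x ^ q ^ n + y ^ q ^ n)
    {θ : 𝕂} (hθ : ‖θ‖ = (q : ℝ)) {A α : ℕ → 𝕂} (hAr : A r ≠ 0) {R : ℝ} (hR : 0 < R)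
    (hα0 : α 0 = 1)
    (hαsum : ∀ z : 𝕂, Summable fun n => α n * z ^ q ^ n)
    (hαR : ∀ n, ‖α n‖ * R ^ q ^ n ≤ R)
    (hαFE : ∀ z : 𝕂, expF 𝕂 q α (θ * z) = phiT 𝕂 q r θ A (expF 𝕂 q α z))
    (x : Fin r → 𝕂) (hxb : IsFqBasis 𝕂 q r θ A x)
    (π : Fin r → 𝕂) (hπ : ∀ j, expF 𝕂 q α (π j / θ) = x j)
    (E : Subfield 𝕂) (hθE : θ ∈ E) (hFqE : ∀ c : 𝕂, c ^ q = c → c ∈ E) (hπE : ∀ j, π j ∈ E)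
    (l : 𝕂) (hl : expF 𝕂 q α l = 0) : l ∈ E := by
  have hq1 : (1 : ℝ) < q := by exact_mod_cast hq
  have hq0 : (0 : ℝ) < q := by linarith
  have hθ0 : θ ≠ 0 := by
    intro h
    rw [h, norm_zero] at hθ
    linarith
  have hadd := expF_add hF hαsum
  let ex : 𝕂 →+ 𝕂 := AddMonoidHom.mk' (expF 𝕂 q α) hadd
  have hex : ∀ z, ex z = expF 𝕂 q α z := fun _ => rfl
  obtain ⟨C, hC⟩ : ∃ C : ℝ, 0 ≤ C ∧ ∀ j, ‖π j‖ ≤ C := by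
    refine ⟨∑ j, ‖π j‖, Finset.sum_nonneg fun _ _ => norm_nonneg _, fun j => ?_⟩
    exact Finset.single_le_sum (f := fun j => ‖π j‖) (fun _ _ => norm_nonneg _)
      (Finset.mem_univ j)
  have hstep : ∀ l : {l : 𝕂 // expF 𝕂 q α l = 0}, ∃ l' : {l : 𝕂 // expF 𝕂 q α l = 0},
      (l : 𝕂) - θ * l' ∈ E ∧ ‖(l : 𝕂) - θ * l'‖ ≤ C := by
    rintro ⟨l, hl⟩
    have h1 : phiT 𝕂 q r θ A (expF 𝕂 q α (l / θ)) = 0 := by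
      rw [← hαFE, mul_div_cancel₀ _ hθ0, hl]
    obtain ⟨c, ⟨hc, hcs⟩, _⟩ := hxb.2 _ h1
    refine ⟨⟨(l - ∑ j, c j * π j) / θ, ?_⟩, ?_, ?_⟩
    · have h2 : (l - ∑ j, c j * π j) / θ = l / θ - ∑ j, c j * (π j / θ) := by
        rw [sub_div, Finset.sum_div]
        simp only [mul_div_assoc]
      rw [h2, ← hex, map_sub, map_sum, hex, hcs, sub_eq_zero]
      apply Finset.sum_congr rfl
      intro j _
      rw [hex, expF_smul (hc j), hπ]
    · rw [mul_div_cancel₀ _ hθ0, sub_sub_cancel]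
      exact E.sum_mem fun j _ => E.mul_mem (hFqE _ (hc j)) (hπE j)
    · simp only
      rw [mul_div_cancel₀ _ hθ0, sub_sub_cancel]
      apply IsUltrametricDist.norm_sum_le_of_forall_le_of_nonneg hC.1
      intro j _
      have hcj : ‖c j‖ ≤ 1 := by
        by_contra hlt
        push Not at hlt
        have h3 : ‖c j‖ ^ 1 < ‖c j‖ ^ q := pow_lt_pow_right₀ hlt (by omega)
        rw [pow_one, ← norm_pow, hc j] at h3
        exact lt_irrefl _ h3
      rw [norm_mul]
      exact (mul_le_of_le_one_left (norm_nonneg _) hcj).trans (hC.2 j)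
  choose nx hnxE hnxC using hstep
  let s : ℕ → {l : 𝕂 // expF 𝕂 q α l = 0} := fun n => nx^[n] ⟨l, hl⟩
  have hs : ∀ n, s (n + 1) = nx (s n) := fun n => Function.iterate_succ_apply' _ _ _
  have hsE : ∀ i n, (s i : 𝕂) - θ ^ n * s (i + n) ∈ E := by
    intro i n
    induction n with
    | zero => simp
    | succ n ih =>
      have h1 := hnxE (s (i + n))
      rw [← hs] at h1
      have h2 := E.add_mem ih (E.mul_mem (E.pow_mem hθE n) h1)
      rw [show i + (n + 1) = i + n + 1 by ring]
      convert h2 using 1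
      ring
  have hsD : ∀ n, ‖(s n : 𝕂)‖ ≤ max ‖l‖ C := by
    intro n
    induction n with
    | zero => exact le_max_left _ _
    | succ n ih =>
      have h1 := hnxC (s n)
      rw [← hs] at h1
      have h2 : ‖θ * (s (n + 1) : 𝕂)‖ ≤ max ‖l‖ C := by
        have : θ * (s (n + 1) : 𝕂) = (s n : 𝕂) + -((s n : 𝕂) - θ * s (n + 1)) := by ring
        rw [this]
        refine (IsUltrametricDist.norm_add_le_max _ _).trans (max_le ih ?_)
        rw [norm_neg]
        exact h1.trans (le_max_right _ _)
      rw [norm_mul, hθ] at h2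
      refine le_trans ?_ h2
      exact le_mul_of_one_le_left (norm_nonneg _) hq1.le
  have hfin : {l : 𝕂 | expF 𝕂 q α l = 0 ∧ ‖l‖ ≤ max ‖(s 0 : 𝕂)‖ C}.Finite := by
    set D := max ‖(s 0 : 𝕂)‖ C
    obtain ⟨n, hn⟩ := pow_unbounded_of_one_lt (D / R) hq1
    have hDn : D / (q : ℝ) ^ n < R := by
      rw [div_lt_iff₀ hR] at hn
      rw [div_lt_iff₀ (by positivity)]
      linarith
    obtain ⟨Q, hQ0, hQ⟩ := exists_torsion_poly (K := 𝕂) (θ := θ) (A := A) hq hr hAr θ A rfl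
      (fun _ _ _ => rfl) n
    apply Set.Finite.of_finite_image (f := fun l => expF 𝕂 q α (l / θ ^ n))
    · refine (Q.rootSet_finite 𝕂).subset ?_
      rintro _ ⟨l, ⟨hl, -⟩, rfl⟩
      rw [Polynomial.mem_rootSet]
      refine ⟨hQ0, ?_⟩
      rw [hQ, ← exp_theta_pow hαFE, mul_div_cancel₀ _ (pow_ne_zero n hθ0), hl]
    · rintro a ⟨-, ha⟩ b ⟨-, hb⟩ hab
      simp only [← hex] at hab
      rw [← sub_eq_zero, ← map_sub, ← sub_div, hex] at hab
      have h1 : ‖(a - b) / θ ^ n‖ < R := by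
        rw [norm_div, norm_pow, hθ]
        refine lt_of_le_of_lt ?_ hDn
        gcongr
        rw [sub_eq_add_neg]
        refine (IsUltrametricDist.norm_add_le_max _ _).trans (max_le ha ?_)
        rwa [norm_neg]
      have h2 := expF_eq_zero hq hR hα0 hαsum hαR _ h1 hab
      rw [div_eq_zero_iff, or_iff_left (pow_ne_zero n hθ0), sub_eq_zero] at h2
      exact h2
  obtain ⟨i, j, hij, hsij⟩ := Set.Finite.exists_lt_map_eq_of_forall_mem
    (f := fun n => (s n : 𝕂))
    (t := {l : 𝕂 | expF 𝕂 q α l = 0 ∧ ‖l‖ ≤ max ‖(s 0 : 𝕂)‖ C})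
    (fun n => ⟨(s n).2, hsD n⟩) hfin
  obtain ⟨d, hd⟩ : ∃ d, j = i + d := ⟨j - i, by omega⟩
  have h1 := hsE i d
  rw [← hd, ← hsij, ← one_sub_mul] at h1
  have hne : 1 - θ ^ d ≠ 0 := by
    intro h
    have h2 : θ ^ d = 1 := (sub_eq_zero.mp h).symm
    have h3 : ‖θ ^ d‖ = 1 := by rw [h2, norm_one]
    rw [norm_pow, hθ] at h3
    have h4 : 1 < (q : ℝ) ^ d := one_lt_pow₀ hq1 (by omega)
    linarith
  have h2 : (s i : 𝕂) ∈ E := by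
    have h3 := E.mul_mem (E.inv_mem (E.sub_mem E.one_mem (E.pow_mem hθE d))) h1
    rwa [inv_mul_cancel_left₀ hne] at h3
  have h3 := E.add_mem (hsE 0 i) (E.mul_mem (E.pow_mem hθE i) h2)
  rw [zero_add, sub_add_cancel] at h3
  exact h3

/-- Torsion lies in any subfield containing `θ`, `𝔽_q`, the `A_i` and the `ξ_j`. -/
lemma torsion_mem {q r N : ℕ} (hF : ∀ n (x y : 𝕂), (x + y) ^ q ^ n = x ^ q ^ n + y ^ q ^ n)
    {θ : 𝕂} {A : ℕ → 𝕂} (x : Fin r → 𝕂) (hxb : IsFqBasis 𝕂 q r θ A x) (ξ : Fin r → 𝕂)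
    (hξ : ∀ j, (phiT 𝕂 q r θ A)^[N - 1] (ξ j) = x j)
    (E : Subfield 𝕂) (hθE : θ ∈ E) (hFqE : ∀ c : 𝕂, c ^ q = c → c ∈ E)
    (hAE : ∀ i, 1 ≤ i → i ≤ r → A i ∈ E) (hξE : ∀ j, ξ j ∈ E) (n : ℕ) (hn : n ≤ N) (y : 𝕂)
    (hy : (phiT 𝕂 q r θ A)^[n] y = 0) : y ∈ E := by
  have hphiE : ∀ z ∈ E, phiT 𝕂 q r θ A z ∈ E := by
    intro z hz
    refine E.add_mem (E.mul_mem hθE hz) (E.sum_mem fun i hi => ?_)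
    rw [Finset.mem_Icc] at hi
    exact E.mul_mem (hAE i hi.1 hi.2) (E.pow_mem hz _)
  have hiterE : ∀ k, ∀ z ∈ E, (phiT 𝕂 q r θ A)^[k] z ∈ E := by
    intro k z hz
    induction k with
    | zero => exact hz
    | succ k ih => rw [Function.iterate_succ_apply']; exact hphiE _ ih
  induction n generalizing y with
  | zero =>
    have : y = 0 := hy
    rw [this]; exact E.zero_mem
  | succ n ih =>
    rw [Function.iterate_succ_apply'] at hy
    obtain ⟨c, ⟨hc, hcs⟩, _⟩ := hxb.2 _ hy
    set t : 𝕂 := ∑ j, c j * (phiT 𝕂 q r θ A)^[N - 1 - n] (ξ j) with ht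
    have htE : t ∈ E := E.sum_mem fun j _ => E.mul_mem (hFqE _ (hc j)) (hiterE _ _ (hξE j))
    have h1 : (phiT 𝕂 q r θ A)^[n] (y - t) = 0 := by
      rw [iter_sub _ (phiT_add hF θ A), ht, iter_sum _ q (phiT_add hF θ A)
        (fun c x hc => phiT_smul θ A hc x) _ _ _ hc, hcs, sub_eq_zero]
      apply Finset.sum_congr rfl
      intro j _
      rw [← Function.iterate_add_apply, show n + (N - 1 - n) = N - 1 by omega, hξ]
    have h2 := E.add_mem (ih (by omega) _ h1) htE
    rwa [sub_add_cancel] at h2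

lemma alpha_mem {q r : ℕ} (hq : 2 ≤ q)
    {θ : 𝕂} (hθ : ‖θ‖ = (q : ℝ)) {A α : ℕ → 𝕂} (hα0 : α 0 = 1)
    (hrec : ∀ n, α n * (θ ^ q ^ n - θ) =
      ∑ i ∈ Finset.Icc 1 r, if i ≤ n then A i * α (n - i) ^ q ^ i else 0)
    (L : Subfield 𝕂) (hθL : θ ∈ L) (hAL : ∀ i, 1 ≤ i → i ≤ r → A i ∈ L) (n : ℕ) : α n ∈ L := by
  induction n using Nat.strong_induction_on with
  | _ n ih =>
  rcases Nat.eq_zero_or_pos n with rfl | hn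
  · rw [hα0]; exact L.one_mem
  have hne : θ ^ q ^ n - θ ≠ 0 := by
    rw [← norm_pos_iff, norm_theta_sub hq hθ hn]
    have : (0 : ℝ) < q := by exact_mod_cast (by omega : 0 < q)
    positivity
  have h1 : α n = (α n * (θ ^ q ^ n - θ)) * (θ ^ q ^ n - θ)⁻¹ := by
    rw [mul_assoc, mul_inv_cancel₀ hne, mul_one]
  rw [h1, hrec]
  refine L.mul_mem (L.sum_mem fun i hi => ?_)
    (L.inv_mem (L.sub_mem (L.pow_mem hθL _) hθL))
  rw [Finset.mem_Icc] at hi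
  split_ifs
  · exact L.mul_mem (hAL i hi.1 hi.2) (L.pow_mem (ih _ (by omega)) _)
  · exact L.zero_mem

end Helpers

theorem stmt5
    (𝕂 : Type) [NontriviallyNormedField 𝕂] [CompleteSpace 𝕂] [IsAlgClosed 𝕂]
    (hna : ∀ x y : 𝕂, ‖x + y‖ ≤ max ‖x‖ ‖y‖)
    (p e q : ℕ) (hp : p.Prime) (hcharp : CharP 𝕂 p) (he : 0 < e) (hqpe : q = p ^ e)
    (θ : 𝕂) (hθ : ‖θ‖ = (q : ℝ))
    (r : ℕ) (hr : 0 < r) (A : ℕ → 𝕂) (hAr : A r ≠ 0)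
    (ND : NewtonData 𝕂 q r θ A)
    (m : ℕ) (hm : IsMuIndex 𝕂 q r A m)
    (x : Fin r → 𝕂) (hxb : IsFqBasis 𝕂 q r θ A x) (hxs : IsStrict 𝕂 q r θ A ND x)
    (N : ℕ) (hN : 1 ≤ N) (ξ : Fin r → 𝕂) (hξ : GoodXi 𝕂 q r N θ A m x ξ)
    (α : ℕ → 𝕂) (hα0 : α 0 = 1)
    (hαsum : ∀ z : 𝕂, Summable fun n => α n * z ^ q ^ n)
    (hαFE : ∀ z : 𝕂, expF 𝕂 q α (θ * z) = phiT 𝕂 q r θ A (expF 𝕂 q α z))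
    (L : Subfield 𝕂)
    (hkL : closure ((Subfield.closure ({θ} ∪ {c : 𝕂 | c ^ q = c}) : Subfield 𝕂) : Set 𝕂) ⊆
      (L : Set 𝕂))
    (hAL : ∀ i, 1 ≤ i → i ≤ r → A i ∈ L)
    (hLfin : ∃ (nn : ℕ) (v : Fin nn → 𝕂), (∀ i, v i ∈ L) ∧ ∀ y ∈ L, ∃ c : Fin nn → 𝕂,
      (∀ i, c i ∈
        closure ((Subfield.closure ({θ} ∪ {c' : 𝕂 | c' ^ q = c'}) : Subfield 𝕂) : Set 𝕂)) ∧
      y = ∑ i, c i * v i) :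
    Subfield.closure ((L : Set 𝕂) ∪ {z : 𝕂 | expF 𝕂 q α z = 0}) =
      Subfield.closure ((L : Set 𝕂) ∪ {z : 𝕂 | (phiT 𝕂 q r θ A)^[N] z = 0}) := by
  classical
  have hum : IsUltrametricDist 𝕂 :=
    IsUltrametricDist.isUltrametricDist_of_forall_norm_add_le_max_norm hna
  have : Fact p.Prime := ⟨hp⟩
  have hq : 2 ≤ q := by
    rw [hqpe]
    exact hp.two_le.trans (Nat.le_self_pow he.ne' p)
  have hq1 : (1 : ℝ) < q := by exact_mod_cast hq
  have hF : ∀ n (x y : 𝕂), (x + y) ^ q ^ n = x ^ q ^ n + y ^ q ^ n := by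
    intro n x y
    rw [hqpe, ← pow_mul]
    exact add_pow_char_pow x y p (e * n)
  have hθ0 : θ ≠ 0 := by
    rw [← norm_pos_iff, hθ]; linarith
  have hR : 0 < Rphi 𝕂 q A m := Real.rpow_pos_of_pos (by linarith) _
  have hrec := alpha_rec hq hF hαsum hαFE
  have hαR := norm_alpha_le hq hθ hm hα0 hrec
  set R := Rphi 𝕂 q A m with hRdef
  set F : Subfield 𝕂 := Subfield.closure ({θ} ∪ {c : 𝕂 | c ^ q = c}) with hFdef
  have hθF : θ ∈ F := Subfield.subset_closure (Or.inl rfl)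
  have hθL : θ ∈ L := hkL (subset_closure hθF)
  have hFqL : ∀ c : 𝕂, c ^ q = c → c ∈ L := fun c hc =>
    hkL (subset_closure (Subfield.subset_closure (Or.inr hc)))
  have hαL := alpha_mem hq hθ hα0 hrec L hθL hAL
  obtain ⟨Alg, hAlg1, hAlg2⟩ := field_facts hq hr hAr F (by rw [hθ]; exact hq1) hθF L hkL hAL hLfin
  -- the exponential preserves closed subfields containing `L`
  have hexpE : ∀ E : Subfield 𝕂, IsClosed (E : Set 𝕂) → L ≤ E → ∀ z ∈ E, expF 𝕂 q α z ∈ E := by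
    intro E hE hLE z hz
    exact hE.mem_of_tendsto (hαsum z).hasSum.tendsto_sum_nat (Eventually.of_forall fun n =>
      E.sum_mem fun k _ => E.mul_mem (hLE (hαL k)) (E.pow_mem hz _))
  have hLle : ∀ S : Set 𝕂, L ≤ Subfield.closure ((L : Set 𝕂) ∪ S) := fun S y hy =>
    Subfield.subset_closure (Or.inl hy)
  have hlog : ∀ j, ∃ w ∈ Subfield.closure ((L : Set 𝕂) ∪ {ξ j}), expF 𝕂 q α w = ξ j := by
    intro j
    have hcl := (hAlg2 _ (hAlg1 N (ξ j) (hξ j).1)).1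
    exact exists_log hq hF hR hα0 hαsum hαR _ hcl (hexpE _ hcl (hLle _)) (ξ j)
      (Subfield.subset_closure (Or.inr rfl)) (hξ j).2.1
  choose w hwE hw using hlog
  have hper : ∀ j, expF 𝕂 q α (θ ^ N * w j) = 0 := by
    intro j
    rw [exp_theta_pow hαFE, hw, (hξ j).1]
  have hperx : ∀ j, expF 𝕂 q α (θ ^ N * w j / θ) = x j := by
    intro j
    have h1 : θ ^ N * w j / θ = θ ^ (N - 1) * w j := by
      obtain ⟨M, rfl⟩ : ∃ M, N = M + 1 := ⟨N - 1, by omega⟩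
      rw [Nat.add_sub_cancel, pow_succ]
      field_simp
    rw [h1, exp_theta_pow hαFE, hw, (hξ j).2.2.1]
  apply le_antisymm
  · rw [Subfield.closure_le]
    rintro l (hl | hl)
    · exact hLle _ hl
    · refine period_mem hq hr hF hθ hAr hR hα0 hαsum hαR hαFE x hxb _ hperx _ (hLle _ hθL)
        (fun c hc => hLle _ (hFqL c hc)) (fun j => ?_) l hl
      refine Subfield.mul_mem _ (Subfield.pow_mem _ (hLle _ hθL) _) ?_
      refine Subfield.closure_mono ?_ (hwE j)
      apply Set.union_subset_union_right
      rw [Set.singleton_subset_iff]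
      exact (hξ j).1
  · rw [Subfield.closure_le]
    rintro y (hy | hy)
    · exact hLle _ hy
    · refine torsion_mem (N := N) hF x hxb ξ (fun j => (hξ j).2.2.1) _ (hLle _ hθL)
        (fun c hc => hLle _ (hFqL c hc)) (fun i h1 h2 => hLle _ (hAL i h1 h2)) (fun j => ?_) N le_rfl
        y hy
      have hwAlg : Alg (w j) := (hAlg2 _ (hAlg1 N (ξ j) (hξ j).1)).2 _ (hwE j)
      have hcl := (hAlg2 _ hwAlg).1
      have h1 : ξ j ∈ Subfield.closure ((L : Set 𝕂) ∪ {w j}) := by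
        rw [← hw j]
        exact hexpE _ hcl (hLle _) _ (Subfield.subset_closure (Or.inr rfl))
      have h2 : Subfield.closure ((L : Set 𝕂) ∪ {w j}) ≤
          Subfield.closure ((L : Set 𝕂) ∪ {z : 𝕂 | expF 𝕂 q α z = 0}) := by
        rw [Subfield.closure_le]
        rintro v (hv | hv)
        · exact hLle _ hv
        · rw [Set.mem_singleton_iff] at hv
          have h3 : v = (θ ^ N)⁻¹ * (θ ^ N * w j) := by
            rw [inv_mul_cancel_left₀ (pow_ne_zero N hθ0), hv]
          rw [h3]
          exact Subfield.mul_mem _ (Subfield.inv_mem _ (Subfield.pow_mem _ (hLle _ hθL) _))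
            (Subfield.subset_closure (Or.inr (hper j)))
      exact h2 h1

end DrinfeldRAT
end
end

section
/- Let φ be a Drinfeld module of rank r over 𝕂, let ℓ ≥ 1, fix ξ_1, …, ξ_r ∈ φ[t^ℓ], and set h_j := Σ_{m=0}^{ℓ−1} φ_{t^{ℓ−1−m}}(ξ_j) t^m and B := (h_j^{(i−1)})_{1≤i,j≤r}. Let W be the r×r matrix with first row (ξ_1, …, ξ_r) and all other entries 0. If det B ≠ 0, then B^{−1} Θ^{−1} B^{(1)} − I = −(t^ℓ/(t−θ)) · B^{−1} W, as matrices with entries in the field of rational functions 𝕂(t). -/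
open Filter

set_option maxHeartbeats 1000000
set_option synthInstance.maxHeartbeats 400000

noncomputable section

namespace DrinfeldRAT

variable (𝕂 : Type) [NontriviallyNormedField 𝕂]

lemma twistRF_C (frobq : 𝕂 →+* 𝕂) (c : 𝕂) :
    twistRF 𝕂 frobq (RatFunc.C c) = RatFunc.C (frobq c) := by
  unfold twistRF
  rw [← RatFunc.algebraMap_C, ← RatFunc.algebraMap_C, RatFunc.coe_mapRingHom_eq_coe_map,
    ← div_one (algebraMap (Polynomial 𝕂) (RatFunc 𝕂) _), ← map_one (algebraMap (Polynomial 𝕂) (RatFunc 𝕂)), RatFunc.map_apply_div]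
  simp

lemma twistRF_X (frobq : 𝕂 →+* 𝕂) :
    twistRF 𝕂 frobq RatFunc.X = RatFunc.X := by
  unfold twistRF
  rw [← RatFunc.algebraMap_X, RatFunc.coe_mapRingHom_eq_coe_map,
    ← div_one (algebraMap (Polynomial 𝕂) (RatFunc 𝕂) _), ← map_one (algebraMap (Polynomial 𝕂) (RatFunc 𝕂)), RatFunc.map_apply_div]
  simp

lemma twist_iter_hRF (q r N : ℕ) (frobq : 𝕂 →+* 𝕂) (hfrob : ∀ c : 𝕂, frobq c = c ^ q)
    (θ : 𝕂) (A : ℕ → 𝕂) (ξ : 𝕂) (n : ℕ) :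
    (fun g => twistRF 𝕂 frobq g)^[n] (hRF 𝕂 q r N θ A ξ) =
      ∑ mm ∈ Finset.range N,
        RatFunc.C (((phiT 𝕂 q r θ A)^[N - 1 - mm] ξ) ^ q ^ n) * RatFunc.X ^ mm := by
  induction n with
  | zero => simp [hRF]
  | succ n ih =>
    rw [Function.iterate_succ_apply', ih]
    simp only [map_sum, map_mul (twistRF 𝕂 frobq), map_pow (twistRF 𝕂 frobq), twistRF_X]
    refine Finset.sum_congr rfl fun mm _ => ?_
    rw [twistRF_C, hfrob, ← pow_mul, ← pow_succ]

lemma hRF_rel (q r N : ℕ) (hN : 1 ≤ N) (frobq : 𝕂 →+* 𝕂) (hfrob : ∀ c : 𝕂, frobq c = c ^ q)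
    (θ : 𝕂) (A : ℕ → 𝕂) (ξ : 𝕂) (hξ : (phiT 𝕂 q r θ A)^[N] ξ = 0) :
    RatFunc.C θ * hRF 𝕂 q r N θ A ξ + ∑ i ∈ Finset.Icc 1 r, RatFunc.C (A i) *
      (fun g => twistRF 𝕂 frobq g)^[i] (hRF 𝕂 q r N θ A ξ) =
      RatFunc.X * hRF 𝕂 q r N θ A ξ - RatFunc.X ^ N * RatFunc.C ξ := by
  have h1 : RatFunc.C θ * hRF 𝕂 q r N θ A ξ + ∑ i ∈ Finset.Icc 1 r, RatFunc.C (A i) *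
      (fun g => twistRF 𝕂 frobq g)^[i] (hRF 𝕂 q r N θ A ξ) =
      ∑ mm ∈ Finset.range N,
        RatFunc.C ((phiT 𝕂 q r θ A)^[N - mm] ξ) * RatFunc.X ^ mm := by
    simp only [twist_iter_hRF 𝕂 q r N frobq hfrob, Finset.mul_sum]
    rw [Finset.sum_comm, hRF, Finset.mul_sum, ← Finset.sum_add_distrib]
    refine Finset.sum_congr rfl fun mm hm => ?_
    have hm' := Finset.mem_range.1 hm
    have : N - mm = (N - 1 - mm) + 1 := by omega
    rw [this, Function.iterate_succ_apply']
    conv_rhs => rw [phiT]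
    simp only [map_add, map_sum, map_mul, add_mul, Finset.sum_mul, mul_assoc]
  rw [h1]
  obtain ⟨M, rfl⟩ : ∃ M, N = M + 1 := ⟨N - 1, by omega⟩
  rw [Finset.sum_range_succ', hRF, Finset.sum_range_succ]
  simp only [Nat.sub_zero, hξ, map_zero, zero_mul, add_zero, Nat.add_sub_cancel, Nat.sub_self,
    Function.iterate_zero, id, mul_add, Finset.mul_sum]
  rw [eq_sub_iff_add_eq]
  refine congrArg₂ _ (Finset.sum_congr rfl fun mm hm => ?_) ?_
  · rw [show M + 1 - (mm + 1) = M - mm by omega]; ring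
  · ring

lemma ThetaRF_mul_castSucc (n : ℕ) (θ : 𝕂) (A : ℕ → 𝕂) (v : Fin (n + 1) → RatFunc 𝕂)
    (i : Fin n) :
    ∑ j, ThetaRF 𝕂 (n + 1) θ A i.castSucc j * v j = v i.succ := by
  rw [Finset.sum_eq_single i.succ]
  · simp [ThetaRF]
  · intro j _ hj
    have : (j : ℕ) ≠ i + 1 := fun h => hj (Fin.ext (by simpa using h))
    simp [ThetaRF, this]
  · simp

lemma ThetaRF_mul_last (n : ℕ) (θ : 𝕂) (A : ℕ → 𝕂) (v : Fin (n + 1) → RatFunc 𝕂) :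
    ∑ j, ThetaRF 𝕂 (n + 1) θ A (Fin.last n) j * v j =
      ((RatFunc.X - RatFunc.C θ) * v 0 -
        ∑ j : Fin n, RatFunc.C (A (j + 1)) * v j.succ) / RatFunc.C (A (n + 1)) := by
  rw [Fin.sum_univ_succ, sub_div, Finset.sum_div, sub_eq_add_neg, ← Finset.sum_neg_distrib]
  refine congrArg₂ _ ?_ (Finset.sum_congr rfl fun j _ => ?_)
  · simp [ThetaRF]; ring
  · simp [ThetaRF]; ring

lemma X_sub_C_ne (θ : 𝕂) : (RatFunc.X - RatFunc.C θ : RatFunc 𝕂) ≠ 0 := by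
  rw [← RatFunc.algebraMap_X, ← RatFunc.algebraMap_C, ← map_sub]
  exact RatFunc.algebraMap_ne_zero (Polynomial.X_sub_C_ne_zero θ)

lemma ThetaRF_det (n : ℕ) (θ : 𝕂) (A : ℕ → 𝕂) (hA : A (n + 1) ≠ 0) :
    (ThetaRF 𝕂 (n + 1) θ A).det ≠ 0 := by
  intro h
  obtain ⟨v, hv, h0⟩ := Matrix.exists_mulVec_eq_zero_iff.2 h
  apply hv
  have hs : ∀ i : Fin n, v i.succ = 0 := fun i => by
    rw [← ThetaRF_mul_castSucc 𝕂 n θ A v i]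
    exact congrFun h0 i.castSucc
  have hl := ThetaRF_mul_last 𝕂 n θ A v
  have hl0 : ∑ j, ThetaRF 𝕂 (n + 1) θ A (Fin.last n) j * v j = 0 := congrFun h0 (Fin.last n)
  have hC : (RatFunc.C (A (n + 1)) : RatFunc 𝕂) ≠ 0 := by simpa using hA
  rw [hl0] at hl
  simp only [hs, mul_zero, Finset.sum_const_zero, sub_zero] at hl
  have := X_sub_C_ne 𝕂 θ
  funext i
  refine Fin.cases ?_ hs i
  have h3 := hl.symm
  rw [div_eq_zero_iff, mul_eq_zero] at h3
  tauto

theorem stmt8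
    (𝕂 : Type) [NontriviallyNormedField 𝕂] [CompleteSpace 𝕂] [IsAlgClosed 𝕂]
    (hna : ∀ x y : 𝕂, ‖x + y‖ ≤ max ‖x‖ ‖y‖)
    (p e q : ℕ) (hp : p.Prime) (hcharp : CharP 𝕂 p) (he : 0 < e) (hqpe : q = p ^ e)
    (θ : 𝕂) (hθ : ‖θ‖ = (q : ℝ))
    (r : ℕ) (hr : 0 < r) (A : ℕ → 𝕂) (hAr : A r ≠ 0)
    (frobq : 𝕂 →+* 𝕂) (hfrob : ∀ c : 𝕂, frobq c = c ^ q)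
    (ℓ : ℕ) (hℓ : 1 ≤ ℓ)
    (ξ : Fin r → 𝕂) (hξ : ∀ j, (phiT 𝕂 q r θ A)^[ℓ] (ξ j) = 0)
    (hdet : (BRF 𝕂 q r ℓ frobq θ A ξ).det ≠ 0) :
    (BRF 𝕂 q r ℓ frobq θ A ξ)⁻¹ * (ThetaRF 𝕂 r θ A)⁻¹ *
        twistMRF 𝕂 frobq 1 (BRF 𝕂 q r ℓ frobq θ A ξ) - 1 =
      -((RatFunc.X ^ ℓ / (RatFunc.X - RatFunc.C θ)) •
        ((BRF 𝕂 q r ℓ frobq θ A ξ)⁻¹ * WRF 𝕂 r ξ)) := by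
  obtain ⟨n, rfl⟩ : ∃ n, r = n + 1 := ⟨r - 1, by omega⟩
  set B := BRF 𝕂 q (n + 1) ℓ frobq θ A ξ with hB
  have hXC := X_sub_C_ne 𝕂 θ
  have hC : (RatFunc.C (A (n + 1)) : RatFunc 𝕂) ≠ 0 := by simpa using hAr
  have hBu : IsUnit B.det := isUnit_iff_ne_zero.2 hdet
  have hTu : IsUnit (ThetaRF 𝕂 (n + 1) θ A).det :=
    isUnit_iff_ne_zero.2 (ThetaRF_det 𝕂 n θ A hAr)
  have key : twistMRF 𝕂 frobq 1 B = ThetaRF 𝕂 (n + 1) θ A *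
      (B - (RatFunc.X ^ ℓ / (RatFunc.X - RatFunc.C θ)) • WRF 𝕂 (n + 1) ξ) := by
    ext i j
    rw [Matrix.mul_apply]
    have hL : twistMRF 𝕂 frobq 1 B i j =
        (fun g => twistRF 𝕂 frobq g)^[(i : ℕ) + 1] (hRF 𝕂 q (n + 1) ℓ θ A (ξ j)) := by
      rw [Function.iterate_succ_apply']
      rfl
    rw [hL]
    refine Fin.lastCases ?_ (fun i => ?_) i
    · rw [ThetaRF_mul_last 𝕂 n θ A (fun k => (B - (RatFunc.X ^ ℓ / (RatFunc.X - RatFunc.C θ)) •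
        WRF 𝕂 (n + 1) ξ) k j)]
      have hrel := hRF_rel 𝕂 q (n + 1) ℓ hℓ frobq hfrob θ A (ξ j) (hξ j)
      rw [← Finset.Ico_add_one_right_eq_Icc, Finset.sum_Ico_eq_sum_range, Nat.add_sub_cancel,
        Finset.sum_range_succ, Finset.sum_range] at hrel
      simp only [Matrix.sub_apply, Matrix.smul_apply, WRF, Matrix.of_apply, hB, BRF, smul_eq_mul,
        Fin.val_succ, Fin.val_zero, Fin.val_last, Function.iterate_zero, id, if_true,
        Nat.succ_ne_zero, if_false, mul_zero, sub_zero]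
      simp only [add_comm 1] at hrel
      rw [eq_div_iff hC, mul_sub, ← mul_assoc, mul_div_cancel₀ _ hXC]
      linear_combination hrel
    · rw [ThetaRF_mul_castSucc 𝕂 n θ A (fun k => (B - (RatFunc.X ^ ℓ /
        (RatFunc.X - RatFunc.C θ)) • WRF 𝕂 (n + 1) ξ) k j)]
      simp [WRF, hB, BRF]
  rw [key, Matrix.mul_assoc, Matrix.nonsing_inv_mul_cancel_left _ _ hTu, Matrix.mul_sub,
    Matrix.nonsing_inv_mul _ hBu, Matrix.mul_smul]
  abel

end DrinfeldRAT
end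
end
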